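/- There exist a constant c > 0 and a threshold K ∈ ℕ such that for every k ≥ K, if the weights a_1, …, a_k are i.i.d. Gaussian N(0, 2/k) (He normal initialization) and the biases b_1, …, b_k are i.i.d. Uniform[0,1] independent of the weights, then the probability that the RNN step map f_{a,b} has a point of period 3 is at least c. -/

import Mathlib

open MeasureTheory ProbabilityTheory Filter Set
open scoped NNReal ENNReal

/-- Clip a real number to the interval `[0,1]`. -/
noncomputable def clip (y : ℝ) : ℝ := min (max y 0) 1

/-- The RNN step map `f_{a,b}(x) = clip (∑ i, a i * ReLU (x - b i))`. -/
noncomputable def rnnStep {k : ℕ} (a b : Fin k → ℝ) (x : ℝ) : ℝ :=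
  clip (∑ i, a i * max (x - b i) 0)

/-- `f` is Li-Yorke chaotic on `[0,1]`: there is an uncountable scrambled set. -/
def LiYorkeChaotic (f : ℝ → ℝ) : Prop :=
  ∃ S : Set ℝ, S ⊆ Set.Icc 0 1 ∧ ¬ S.Countable ∧
    ∀ x ∈ S, ∀ y ∈ S, x ≠ y →
      Filter.liminf (fun n => |f^[n] x - f^[n] y|) Filter.atTop = 0 ∧
      0 < Filter.limsup (fun n => |f^[n] x - f^[n] y|) Filter.atTop

/-- The joint law of `k` i.i.d. `N(0, v)` weights and `k` i.i.d. `Uniform[0,1]`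
biases, independent of each other. -/
noncomputable def rnnMeasure (k : ℕ) (v : ℝ≥0) :
    Measure ((Fin k → ℝ) × (Fin k → ℝ)) :=
  (Measure.pi fun _ => gaussianReal 0 v).prod
    (Measure.pi fun _ => volume.restrict (Set.Icc (0:ℝ) 1))

/-- `f` has a point of period 3 in `[0,1]`. -/
def HasPeriod3 (f : ℝ → ℝ) : Prop :=
  ∃ x ∈ Set.Icc (0:ℝ) 1, f (f (f x)) = x ∧ f x ≠ x

/-- A continuous map with `0 ↦ 0`, `1/2 ↦ 1`, `1 ↦ 0` has a point of period 3. -/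
lemma hasPeriod3_of_horseshoe {f : ℝ → ℝ} (hf : Continuous f)
    (h0 : f 0 = 0) (h2 : f (1 / 2) = 1) (h1 : f 1 = 0) : HasPeriod3 f := by
  obtain ⟨z, ⟨⟨hz0, hz2⟩, hfz⟩, hzmax⟩ :=
    (isCompact_Icc.inter_right (isClosed_eq hf continuous_id) :
      IsCompact (Icc (0 : ℝ) (1 / 2) ∩ {x | f x = id x})).exists_isGreatest
      ⟨0, by simp, by simpa using h0⟩
  simp only [mem_ofPred_eq, id] at hfz
  have hz : z < 1 / 2 := lt_of_le_of_ne hz2 fun h => by rw [h, h2] at hfz; norm_num at hfz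
  obtain ⟨y, ⟨hy1, hy2⟩, hfy⟩ := intermediate_value_Icc hz2 hf.continuousOn
    (show (1 / 2 : ℝ) ∈ Icc (f z) (f (1 / 2)) by rw [hfz, h2]; constructor <;> linarith)
  have hzy : z < y := lt_of_le_of_ne hy1 fun h => by rw [← h, hfz] at hfy; linarith
  obtain ⟨x, ⟨hx1, hx2⟩, hfx⟩ := intermediate_value_Icc hz2 hf.continuousOn
    (show y ∈ Icc (f z) (f (1 / 2)) by rw [hfz, h2]; constructor <;> linarith)
  have hzx : z < x := lt_of_le_of_ne hx1 fun h => by rw [← h, hfz] at hfx; linarith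
  have hcont : Continuous fun t => f (f (f t)) - t := by fun_prop
  obtain ⟨w, ⟨hw1, hw2⟩, hw⟩ := intermediate_value_Icc' hx2 hcont.continuousOn
    (show (0 : ℝ) ∈ Icc (f (f (f (1 / 2))) - 1 / 2) (f (f (f x)) - x) by
      rw [h2, h1, h0, hfx, hfy, h2]; constructor <;> linarith)
  refine ⟨w, ⟨by linarith, by linarith⟩, by simpa [sub_eq_zero] using hw, fun h => ?_⟩
  have : w ≤ z := hzmax ⟨⟨by linarith, by linarith⟩, h⟩
  linarith

lemma continuous_rnnStep {k : ℕ} (a b : Fin k → ℝ) : Continuous (rnnStep a b) := by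
  unfold rnnStep clip
  fun_prop

/-- The law of a linear combination of i.i.d. centred Gaussians. -/
lemma map_sum_mul_pi_gaussianReal {k : ℕ} (v : ℝ≥0) (s : Finset (Fin k)) (c : Fin k → ℝ) :
    (Measure.pi fun _ : Fin k => gaussianReal 0 v).map (fun a => ∑ i ∈ s, c i * a i) =
      gaussianReal 0 (v * ∑ i ∈ s, c i ^ 2).toNNReal := by
  classical
  set d : Fin k → ℝ := fun i => if i ∈ s then c i else 0 with hd
  have hsum : (fun a : Fin k → ℝ => ∑ i ∈ s, c i * a i) = ∑ i, fun a => d i * a i := by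
    ext a
    simp [hd]
  have hmem : ∀ i, MemLp (fun x : ℝ => d i * x) 2 (gaussianReal 0 v) := fun i =>
    (memLp_id_gaussianReal 2).const_mul (d i)
  have hlaw : ∀ i, HasGaussianLaw (fun a : Fin k → ℝ => d i * a i)
      (Measure.pi fun _ : Fin k => gaussianReal 0 v) := fun i => by
    constructor
    have h : (Measure.pi fun _ : Fin k => gaussianReal 0 v).map (fun a => d i * a i) =
        (gaussianReal 0 v).map (d i * ·) := by
      conv_rhs => rw [← (measurePreserving_eval (fun _ : Fin k => gaussianReal 0 v) i).map_eq,
        Measure.map_map (by fun_prop) (by fun_prop)]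
      rfl
    rw [h, gaussianReal_map_const_mul]
    infer_instance
  have hind : iIndepFun (fun i (a : Fin k → ℝ) => d i * a i)
      (Measure.pi fun _ : Fin k => gaussianReal 0 v) :=
    iIndepFun_pi (X := fun i x => d i * x) fun i => by fun_prop
  rw [hsum, (iIndepFun.hasGaussianLaw hlaw hind).sum.map_eq_gaussianReal,
    variance_sum_pi (X := fun i x => d i * x) hmem]
  congr 1
  · simp only [Finset.sum_apply]
    rw [integral_finsetSum _ fun i _ => (hlaw i).integrable]
    refine Finset.sum_eq_zero fun i _ => ?_
    rw [integral_const_mul, integral_comp_eval (μ := fun _ : Fin k => gaussianReal 0 v)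
      (f := fun x : ℝ => x) (by fun_prop), integral_id_gaussianReal, mul_zero]
  · congr 1
    have hvar : ∀ i, Var[fun x => d i * x; gaussianReal 0 v] = d i ^ 2 * v := fun i => by
      rw [variance_const_mul, variance_fun_id_gaussianReal]
    rw [Finset.sum_congr rfl fun i _ => hvar i]
    simp [hd, Finset.mul_sum, mul_comm, ite_pow]

lemma gaussianReal_real_Ici_ge {δ M : ℝ} (hδ : 0 < δ) (hM : 0 ≤ M) {w : ℝ≥0} (hw : δ ≤ w) :
    (gaussianReal 0 1).real (Ici (M / √δ)) ≤ (gaussianReal 0 w).real (Ici M) := by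
  have h : gaussianReal 0 w = (gaussianReal 0 1).map (√w * ·) := by
    rw [gaussianReal_map_const_mul]
    congr 1
    · simp
    · ext; simp
  rw [h, map_measureReal_apply (by fun_prop) measurableSet_Ici]
  refine measureReal_mono fun x hx => ?_
  have hsδ : 0 < √δ := Real.sqrt_pos.2 hδ
  have h1 : √δ ≤ √w := Real.sqrt_le_sqrt hw
  have h2 : M ≤ x * √δ := (div_le_iff₀ hsδ).1 hx
  have hx0 : 0 ≤ x := le_trans (by positivity) hx
  simp only [mem_preimage, mem_Ici]
  nlinarith

lemma gaussianReal_real_Ici_pos (M : ℝ) : 0 < (gaussianReal 0 1).real (Ici M) := by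
  rw [measureReal_def, ENNReal.toReal_pos_iff]
  refine ⟨pos_iff_ne_zero.2 fun h => ?_, measure_lt_top _ _⟩
  have := gaussianReal_absolutelyContinuous' 0 (v := 1) one_ne_zero h
  simp at this

/-- Chebyshev's inequality for the upper tail of a centred Gaussian. -/
lemma gaussianReal_real_Ici_le {M : ℝ} (hM : 0 < M) (w : ℝ≥0) :
    (gaussianReal 0 w).real (Ici M) ≤ w / M ^ 2 := by
  have h := meas_ge_le_variance_div_sq (memLp_id_gaussianReal (μ := 0) (v := w) 2) hM
  rw [variance_id_gaussianReal] at h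
  have h' := ENNReal.toReal_mono ENNReal.ofReal_ne_top h
  rw [ENNReal.toReal_ofReal (by positivity)] at h'
  refine le_trans (measureReal_mono fun x hx => ?_) h'
  simp only [mem_ofPred_eq, id, integral_id_gaussianReal, sub_zero]
  exact le_trans hx (le_abs_self x)

/-- A uniform lower bound on the probability that two correlated centred Gaussian sums satisfy
`1 ≤ ∑ i ∈ s, c i * a i` and `∑ i, d i * a i ≤ 0`, when `d` carries enough weight off `s`. -/
lemma exists_pos_le_pi_gaussianReal {δ C : ℝ} (hδ : 0 < δ) (hC : 0 < C) :
    ∃ p : ℝ, 0 < p ∧ ∀ (k : ℕ) (v : ℝ≥0) (s : Finset (Fin k)) (c d : Fin k → ℝ),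
      δ ≤ v * ∑ i ∈ s, c i ^ 2 → v * ∑ i ∈ s, d i ^ 2 ≤ C → δ ≤ v * ∑ i ∈ sᶜ, d i ^ 2 →
      p ≤ (Measure.pi fun _ : Fin k => gaussianReal 0 v).real
        {a | 1 ≤ ∑ i ∈ s, c i * a i ∧ ∑ i, d i * a i ≤ 0} := by
  set p₁ := (gaussianReal 0 1).real (Ici (1 / √δ))
  have hp₁pos : 0 < p₁ := gaussianReal_real_Ici_pos _
  set M := √(2 * C / p₁) with hM
  have hMpos : 0 < M := Real.sqrt_pos.2 (by positivity)
  have hMsq : C / M ^ 2 = p₁ / 2 := by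
    rw [hM, Real.sq_sqrt (by positivity)]
    field_simp
  set p₂ := (gaussianReal 0 1).real (Ici (M / √δ))
  have hp₂pos : 0 < p₂ := gaussianReal_real_Ici_pos _
  refine ⟨p₁ / 2 * p₂, by positivity, fun k v s c d hc hd hd' => ?_⟩
  set μ := Measure.pi fun _ : Fin k => gaussianReal 0 v
  have tail : ∀ (t : Finset (Fin k)) (e : Fin k → ℝ) (r : ℝ),
      μ.real {a | r ≤ ∑ i ∈ t, e i * a i} =
        (gaussianReal 0 (v * ∑ i ∈ t, e i ^ 2).toNNReal).real (Ici r) := fun t e r => by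
    rw [← map_sum_mul_pi_gaussianReal,
      map_measureReal_apply (by fun_prop) measurableSet_Ici]
    rfl
  have hS : p₁ ≤ μ.real {a | 1 ≤ ∑ i ∈ s, c i * a i} := by
    rw [tail]
    exact gaussianReal_real_Ici_ge hδ zero_le_one (hc.trans (Real.le_coe_toNNReal _))
  have hS' : μ.real {a | M ≤ ∑ i ∈ s, d i * a i} ≤ p₁ / 2 := by
    rw [tail]
    refine (gaussianReal_real_Ici_le hMpos _).trans ?_
    rw [← hMsq, Real.coe_toNNReal _ (by positivity)]
    gcongr
  have hT : p₂ ≤ μ.real {a | M ≤ ∑ i ∈ sᶜ, -d i * a i} := by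
    rw [tail]
    refine gaussianReal_real_Ici_ge hδ hMpos.le (le_trans ?_ (Real.le_coe_toNNReal _))
    simpa using hd'
  have hSS : p₁ / 2 ≤ μ.real {a | 1 ≤ ∑ i ∈ s, c i * a i ∧ ∑ i ∈ s, d i * a i ≤ M} := by
    have hle : μ.real {a | 1 ≤ ∑ i ∈ s, c i * a i} ≤
        μ.real {a | 1 ≤ ∑ i ∈ s, c i * a i ∧ ∑ i ∈ s, d i * a i ≤ M} +
          μ.real {a | M ≤ ∑ i ∈ s, d i * a i} := by
      refine (measureReal_mono fun a ha => ?_).trans (measureReal_union_le _ _)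
      rcases le_total (∑ i ∈ s, d i * a i) M with h | h
      · exact Or.inl ⟨ha, h⟩
      · exact Or.inr h
    linarith
  have hind : iIndepFun (fun i (a : Fin k → ℝ) => a i) μ :=
    iIndepFun_pi (X := fun _ x => x) fun i => by fun_prop
  have hind' := hind.indepFun_finset s sᶜ disjoint_compl_right fun i => measurable_pi_apply i
  have hmul := hind'.measure_inter_preimage_eq_mul
    {x : s → ℝ | 1 ≤ ∑ i : s, c i * x i ∧ ∑ i : s, d i * x i ≤ M}
    {x : ↥(sᶜ) → ℝ | M ≤ ∑ i : ↥(sᶜ), -d i * x i}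
    (by
      rw [ofPred_and]
      exact (measurableSet_le (by fun_prop) (by fun_prop)).inter
        (measurableSet_le (by fun_prop) (by fun_prop)))
    (measurableSet_le (by fun_prop) (by fun_prop))
  have hpre₁ : (fun (a : Fin k → ℝ) (i : s) => a i) ⁻¹'
      {x : s → ℝ | 1 ≤ ∑ i : s, c i * x i ∧ ∑ i : s, d i * x i ≤ M} =
      {a | 1 ≤ ∑ i ∈ s, c i * a i ∧ ∑ i ∈ s, d i * a i ≤ M} := by
    ext a
    simp only [mem_preimage, mem_ofPred_eq, Finset.sum_coe_sort s fun i => c i * a i,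
      Finset.sum_coe_sort s fun i => d i * a i]
  have hpre₂ : (fun (a : Fin k → ℝ) (i : ↥(sᶜ)) => a i) ⁻¹'
      {x : ↥(sᶜ) → ℝ | M ≤ ∑ i : ↥(sᶜ), -d i * x i} = {a | M ≤ ∑ i ∈ sᶜ, -d i * a i} := by
    ext a
    simp only [mem_preimage, mem_ofPred_eq, Finset.sum_coe_sort sᶜ fun i => -d i * a i]
  rw [hpre₁, hpre₂] at hmul
  have hmul' := congrArg ENNReal.toReal hmul
  rw [ENNReal.toReal_mul] at hmul'
  calc p₁ / 2 * p₂ ≤ _ * _ := mul_le_mul hSS hT hp₂pos.le measureReal_nonneg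
    _ = _ := hmul'.symm
    _ ≤ _ := measureReal_mono fun a ha => ?_
  obtain ⟨⟨h1, h2⟩, h3⟩ := ha
  refine ⟨h1, ?_⟩
  simp only [mem_ofPred_eq, neg_mul, Finset.sum_neg_distrib] at h3
  rw [← Finset.sum_add_sum_compl s]
  linarith

/-- By Chebyshev's inequality, i.i.d. samples rarely visit a set of probability `1/4` less than
half as often as expected. -/
lemma pi_real_card_le {ν : Measure ℝ} [IsProbabilityMeasure ν] {A : Set ℝ}
    (hA : MeasurableSet A) (hνA : ν.real A = 1 / 4) {k : ℕ} (hk : 0 < k) :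
    (Measure.pi fun _ : Fin k => ν).real
      {b | ∑ i, A.indicator (fun _ => (1 : ℝ)) (b i) ≤ k / 8} ≤ 16 / k := by
  set g : ℝ → ℝ := A.indicator fun _ => 1 with hg
  have hgm : Measurable g := measurable_const.indicator hA
  have hg01 : ∀ x, g x ∈ Icc (0 : ℝ) 1 := fun x => by
    by_cases hx : x ∈ A <;> simp [hg, hx]
  have hgL : MemLp g 2 ν := memLp_of_bounded (ae_of_all _ hg01) hgm.aestronglyMeasurable 2
  have hL : ∀ i : Fin k, MemLp (fun b : Fin k → ℝ => g (b i)) 2 (Measure.pi fun _ => ν) :=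
    fun i => hgL.comp_measurePreserving (measurePreserving_eval (fun _ : Fin k => ν) i)
  have hX : MemLp (∑ i, fun b : Fin k → ℝ => g (b i)) 2 (Measure.pi fun _ => ν) :=
    memLp_finsetSum' _ fun i _ => hL i
  have hk' : (0 : ℝ) < k := by exact_mod_cast hk
  have hmean : ∫ b, (∑ i, fun b : Fin k → ℝ => g (b i)) b ∂(Measure.pi fun _ => ν) =
      (k : ℝ) / 4 := by
    simp only [Finset.sum_apply]
    rw [integral_finsetSum _ fun i _ => (hL i).integrable one_le_two]
    simp_rw [integral_comp_eval (μ := fun _ : Fin k => ν) (f := g) hgm.aestronglyMeasurable]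
    rw [hg, integral_indicator_const _ hA, hνA]
    simp
    ring
  have hvar : Var[∑ i, fun b : Fin k → ℝ => g (b i); Measure.pi fun _ => ν] ≤ k / 4 := by
    rw [variance_sum_pi (X := fun _ => g) fun _ => hgL]
    have := variance_le_sq_of_bounded (μ := ν) (ae_of_all _ hg01) hgm.aemeasurable
    calc ∑ _i : Fin k, Var[g; ν] ≤ ∑ _i : Fin k, (1 / 4 : ℝ) :=
          Finset.sum_le_sum fun i _ => this.trans (by norm_num)
      _ = k / 4 := by simp; ring
  have h := ENNReal.toReal_mono ENNReal.ofReal_ne_top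
    (meas_ge_le_variance_div_sq hX (show (0 : ℝ) < k / 8 by positivity))
  rw [ENNReal.toReal_ofReal (div_nonneg (variance_nonneg _ _) (by positivity)), hmean] at h
  calc _ ≤ _ := measureReal_mono fun b hb => ?_
    _ ≤ _ := h
    _ ≤ k / 4 / (k / 8) ^ 2 := by gcongr
    _ = 16 / k := by field_simp; norm_num
  simp only [mem_ofPred_eq, Finset.sum_apply] at hb ⊢
  rw [abs_sub_comm]
  exact le_trans (by linarith) (le_abs_self _)

lemma isProbabilityMeasure_restrict_Icc_zero_one :
    IsProbabilityMeasure (volume.restrict (Icc (0 : ℝ) 1)) :=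
  ⟨by simp⟩

/-- If more than an eighth of the indices have biases in `A`, and `e ≥ 1/4` for those indices, then
the scaled sum of `e ^ 2` over any index set containing them is at least `1/64`. -/
lemma le_two_div_mul_sum_sq {k : ℕ} (hk : 0 < k) {A : Set ℝ} {b e : Fin k → ℝ}
    {s : Finset (Fin k)} (hcard : k / 8 ≤ ∑ i, A.indicator (fun _ => (1 : ℝ)) (b i))
    (hs : ∀ i, b i ∈ A → i ∈ s ∧ 1 / 4 ≤ e i) :
    1 / 64 ≤ ((2 / k : ℝ≥0) : ℝ) * ∑ i ∈ s, e i ^ 2 := by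
  have hk' : (0 : ℝ) < k := by exact_mod_cast hk
  have h : 1 / 16 * ∑ i, A.indicator (fun _ => (1 : ℝ)) (b i) ≤ ∑ i ∈ s, e i ^ 2 := by
    rw [Finset.mul_sum, ← Finset.sum_subset (Finset.subset_univ s)]
    · refine Finset.sum_le_sum fun i _ => ?_
      by_cases hi : b i ∈ A
      · simp only [hi, indicator_of_mem]
        nlinarith [(hs i hi).2]
      · simp only [hi, not_false_eq_true, indicator_of_notMem]
        nlinarith [sq_nonneg (e i)]
    · intro i _ his
      rw [indicator_of_notMem fun hi => his (hs i hi).1, mul_zero]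
  push_cast
  calc (1 / 64 : ℝ) = 2 / k * (1 / 16 * (k / 8)) := by field_simp; norm_num
    _ ≤ 2 / k * ∑ i ∈ s, e i ^ 2 := by
      gcongr
      exact le_trans (by gcongr) h

/-- Bias vectors in `[0,1]^k` that visit both `[0,1/4]` and `[1/2,3/4]` more than `k/8` times. -/
def balancedBiases (k : ℕ) : Set (Fin k → ℝ) :=
  {b | (∀ i, b i ∈ Icc (0 : ℝ) 1) ∧
    k / 8 < ∑ i, (Icc (0 : ℝ) (1 / 4)).indicator (fun _ => (1 : ℝ)) (b i) ∧
    k / 8 < ∑ i, (Icc (1 / 2 : ℝ) (3 / 4)).indicator (fun _ => (1 : ℝ)) (b i)}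

lemma measurableSet_balancedBiases (k : ℕ) : MeasurableSet (balancedBiases k) := by
  have hind : ∀ x y : ℝ, Measurable fun b : Fin k → ℝ =>
      ∑ i, (Icc x y).indicator (fun _ => (1 : ℝ)) (b i) := fun x y =>
    Finset.measurable_fun_sum _ fun i _ =>
      (measurable_const.indicator measurableSet_Icc).comp (measurable_pi_apply i)
  have h : MeasurableSet {b : Fin k → ℝ | ∀ i, b i ∈ Icc (0 : ℝ) 1} := by
    simp only [ofPred_forall]
    exact MeasurableSet.iInter fun i => measurable_pi_apply i measurableSet_Icc
  exact h.inter ((measurableSet_lt measurable_const (hind _ _)).inter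
    (measurableSet_lt measurable_const (hind _ _)))

lemma half_le_pi_balancedBiases {k : ℕ} (hk : 64 ≤ k) :
    1 / 2 ≤ (Measure.pi fun _ : Fin k => volume.restrict (Icc (0 : ℝ) 1)).real
      (balancedBiases k) := by
  have := isProbabilityMeasure_restrict_Icc_zero_one
  set ν := volume.restrict (Icc (0 : ℝ) 1) with hν
  have hν4 : ∀ x y : ℝ, 0 ≤ x → y ≤ 1 → y - x = 1 / 4 → ν.real (Icc x y) = 1 / 4 :=
    fun x y hx hy hxy => by
      rw [hν, measureReal_restrict_apply measurableSet_Icc,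
        inter_eq_left.2 (Icc_subset_Icc hx hy), Real.volume_real_Icc, hxy]
      norm_num
  have hA := pi_real_card_le measurableSet_Icc
    (hν4 0 (1 / 4) le_rfl (by norm_num) (by norm_num)) (k := k) (by omega)
  have hB := pi_real_card_le measurableSet_Icc
    (hν4 (1 / 2) (3 / 4) (by norm_num) (by norm_num) (by norm_num)) (k := k) (by omega)
  have hbox : ∀ᵐ b ∂(Measure.pi fun _ : Fin k => ν), ∀ i, b i ∈ Icc (0 : ℝ) 1 :=
    ae_all_iff.2 fun i => (Measure.quasiMeasurePreserving_eval (fun _ : Fin k => ν) i).ae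
      (ae_restrict_mem measurableSet_Icc)
  have hbox' : (Measure.pi fun _ : Fin k => ν).real {b | ¬ ∀ i, b i ∈ Icc (0 : ℝ) 1} = 0 := by
    rw [measureReal_def, ae_iff.1 hbox, ENNReal.toReal_zero]
  have hcompl : (Measure.pi fun _ : Fin k => ν).real (balancedBiases k)ᶜ ≤ 16 / k + 16 / k := by
    calc _ ≤ (Measure.pi fun _ : Fin k => ν).real ({b | ¬ ∀ i, b i ∈ Icc (0 : ℝ) 1} ∪
          ({b | ∑ i, (Icc (0 : ℝ) (1 / 4)).indicator (fun _ => (1 : ℝ)) (b i) ≤ k / 8} ∪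
          {b | ∑ i, (Icc (1 / 2 : ℝ) (3 / 4)).indicator (fun _ => (1 : ℝ)) (b i) ≤ k / 8})) := by
          refine measureReal_mono fun b hb => ?_
          by_contra h
          simp only [mem_union, mem_ofPred_eq, not_or, not_not, not_le] at h
          exact hb h
      _ ≤ 0 + (16 / k + 16 / k) := by
          refine (measureReal_union_le _ _).trans (add_le_add hbox'.le ?_)
          exact (measureReal_union_le _ _).trans (add_le_add hA hB)
      _ = _ := zero_add _
  have hk' : (16 : ℝ) / k ≤ 1 / 4 := by
    have : (64 : ℝ) ≤ k := by exact_mod_cast hk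
    rw [div_le_div_iff₀ (by linarith) (by norm_num)]
    linarith
  rw [probReal_compl_eq_one_sub (measurableSet_balancedBiases k)] at hcompl
  linarith

/-- **Period 3 at He initialization.** With weights i.i.d. `N(0, 2/k)` and biases
i.i.d. `Uniform[0,1]`, for all sufficiently large `k` the RNN step map has a point
of period 3 with probability at least some constant `c > 0`. -/
theorem period_three_at_He_initialization :
    ∃ c : ℝ, 0 < c ∧ ∃ K : ℕ, ∀ k : ℕ, K ≤ k →
      ENNReal.ofReal c ≤
        rnnMeasure k (2 / k) {p | HasPeriod3 (rnnStep p.1 p.2)} := by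
  obtain ⟨p, hp, hgauss⟩ := exists_pos_le_pi_gaussianReal (δ := 1 / 64) (C := 2)
    (by norm_num) (by norm_num)
  refine ⟨p * (1 / 2), by positivity, 64, fun k hk => ?_⟩
  have := isProbabilityMeasure_restrict_Icc_zero_one
  have hk0 : 0 < k := by omega
  have hk' : (0 : ℝ) < k := by exact_mod_cast hk0
  set E : Set ((Fin k → ℝ) × (Fin k → ℝ)) :=
    {q | 1 ≤ ∑ i, q.1 i * max (1 / 2 - q.2 i) 0 ∧ ∑ i, q.1 i * max (1 - q.2 i) 0 ≤ 0} ∩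
      {q | q.2 ∈ balancedBiases k}
  have hEm : MeasurableSet E := by
    refine MeasurableSet.inter ?_ (measurable_snd (measurableSet_balancedBiases k))
    rw [ofPred_and]
    exact (measurableSet_le (by fun_prop) (by fun_prop)).inter
      (measurableSet_le (by fun_prop) (by fun_prop))
  have hfiber : ∀ b ∈ balancedBiases k, ENNReal.ofReal p ≤
      (Measure.pi fun _ : Fin k => gaussianReal 0 (2 / k)) ((fun a => (a, b)) ⁻¹' E) := by
    intro b hb
    have ⟨hb01, hbA, hbB⟩ := hb
    set s : Finset (Fin k) := {i | b i < 1 / 2} with hs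
    have hc : 1 / 64 ≤ ((2 / k : ℝ≥0) : ℝ) * ∑ i ∈ s, (1 / 2 - b i) ^ 2 :=
      le_two_div_mul_sum_sq hk0 hbA.le fun i hi =>
        ⟨by simp only [hs, Finset.mem_filter_univ]; linarith [hi.2], by linarith [hi.2]⟩
    have hd' : 1 / 64 ≤ ((2 / k : ℝ≥0) : ℝ) * ∑ i ∈ sᶜ, (1 - b i) ^ 2 :=
      le_two_div_mul_sum_sq hk0 hbB.le fun i hi =>
        ⟨by simp only [hs, Finset.mem_compl, Finset.mem_filter_univ]; linarith [hi.1],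
          by linarith [hi.2]⟩
    have hd : ((2 / k : ℝ≥0) : ℝ) * ∑ i ∈ s, (1 - b i) ^ 2 ≤ 2 := by
      have h1 : ∑ i ∈ s, (1 - b i) ^ 2 ≤ (k : ℝ) := by
        calc ∑ i ∈ s, (1 - b i) ^ 2 ≤ ∑ _i ∈ s, (1 : ℝ) := Finset.sum_le_sum fun i _ => by
              nlinarith [(hb01 i).1, (hb01 i).2]
          _ ≤ ∑ _i : Fin k, (1 : ℝ) :=
              Finset.sum_le_sum_of_subset_of_nonneg (Finset.subset_univ s) (by simp)
          _ = k := by simp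
      push_cast
      calc (2 : ℝ) / k * ∑ i ∈ s, (1 - b i) ^ 2 ≤ 2 / k * k := by gcongr
        _ = 2 := by field_simp
    rw [ENNReal.ofReal_le_iff_le_toReal (measure_ne_top _ _)]
    refine (hgauss k (2 / k) s _ _ hc hd hd').trans (measureReal_mono ?_)
    rintro a ⟨h1, h2⟩
    refine ⟨⟨h1.trans_eq ?_, le_of_eq_of_le ?_ h2⟩, hb⟩
    · rw [hs, Finset.sum_filter]
      refine Finset.sum_congr rfl fun i _ => ?_
      split_ifs with hi
      · rw [max_eq_left (by linarith), mul_comm]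
      · rw [max_eq_right (by linarith), mul_zero]
    · refine Finset.sum_congr rfl fun i _ => ?_
      rw [max_eq_left (by linarith [(hb01 i).2]), mul_comm]
  have hsub : E ⊆ {q | HasPeriod3 (rnnStep q.1 q.2)} := by
    rintro ⟨a, b⟩ ⟨⟨h1, h2⟩, hb, -⟩
    refine hasPeriod3_of_horseshoe (continuous_rnnStep a b) ?_ ?_ ?_
    · have : ∑ i, a i * max (0 - b i) 0 = 0 := Finset.sum_eq_zero fun i _ => by
        rw [max_eq_right (by linarith [(hb i).1]), mul_zero]
      simp only [rnnStep, clip, this]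
      norm_num
    · exact min_eq_right (le_max_of_le_left h1)
    · simp only [rnnStep, clip]
      rw [max_eq_right h2]
      norm_num
  refine le_trans ?_ (measure_mono hsub)
  rw [rnnMeasure, Measure.prod_apply_symm hEm, ENNReal.ofReal_mul hp.le]
  calc ENNReal.ofReal p * ENNReal.ofReal (1 / 2)
      ≤ ENNReal.ofReal p * (Measure.pi fun _ : Fin k => volume.restrict (Icc (0 : ℝ) 1))
          (balancedBiases k) := by
        gcongr
        exact (ENNReal.ofReal_le_iff_le_toReal (measure_ne_top _ _)).2
          (half_le_pi_balancedBiases hk)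
    _ = ∫⁻ _b in balancedBiases k, ENNReal.ofReal p
          ∂(Measure.pi fun _ : Fin k => volume.restrict (Icc (0 : ℝ) 1)) :=
        (setLIntegral_const _ _).symm
    _ ≤ _ := (setLIntegral_mono' (measurableSet_balancedBiases k) hfiber).trans
        (setLIntegral_le_lintegral _ _)
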